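/- arXiv:1312.6154 — 8 statements merged into one kernel-verified Lean document; each statement's English description precedes it below -/
import Mathlib

section
/- Let n ≥ 7 be an integer, δ, ν real, and let (I₀, φ₀) with I₀ > 0 be a critical point of the model Hamiltonian h, so that sin(nφ₀) = 0 and δ = f_σ(I₀,ν) with σ = cos(nφ₀) ∈ {+1,−1}. Then the mixed second derivative ∂²h/∂I∂φ vanishes at (I₀,φ₀) and the determinant of the Hessian matrix of h at (I₀,φ₀) equals σ·n²·I₀^{n/2}·(∂f_σ/∂I)(I₀,ν). In particular, the critical point is a saddle (negative Hessian determinant) if and only if σ·(∂f_σ/∂I)(I₀,ν) < 0. -/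
/-- The model normal-form Hamiltonian `h(I,φ) = δI + νI² + I³ + I^(n/2)·cos(nφ)`
(real power). -/
noncomputable def modelH (n : ℕ) (δ ν I φ : ℝ) : ℝ :=
  δ * I + ν * I ^ 2 + I ^ 3 + I ^ ((n : ℝ) / 2) * Real.cos (n * φ)

/-- `f_σ(I,ν) = −2νI − 3I² − σ·(n/2)·I^(n/2−1)` (real power). -/
noncomputable def fSigma (n : ℕ) (σ I ν : ℝ) : ℝ :=
  -2 * ν * I - 3 * I ^ 2 - σ * ((n : ℝ) / 2) * I ^ ((n : ℝ) / 2 - 1)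

theorem hasDerivAt_modelH_angle (n : ℕ) (δ ν I φ : ℝ) :
    HasDerivAt (fun φ => modelH n δ ν I φ)
      (-(n * I ^ ((n : ℝ) / 2)) * Real.sin (n * φ)) φ := by
  unfold modelH
  have h := ((((hasDerivAt_id φ).const_mul (n : ℝ)).cos).const_mul
    (I ^ ((n : ℝ) / 2))).const_add (δ * I + ν * I ^ 2 + I ^ 3)
  refine h.congr_deriv ?_
  simp only [id]
  ring

theorem hasDerivAt_modelH_action (n : ℕ) (δ ν φ : ℝ) {I : ℝ} (hI : 0 < I) :
    HasDerivAt (fun I => modelH n δ ν I φ)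
      (δ - fSigma n (Real.cos (n * φ)) I ν) I := by
  unfold modelH fSigma
  have h := ((((hasDerivAt_id I).const_mul δ).add ((hasDerivAt_pow 2 I).const_mul ν)).add
    (hasDerivAt_pow 3 I)).add
    ((Real.hasDerivAt_rpow_const (p := (n : ℝ) / 2) (Or.inl hI.ne')).mul_const
      (Real.cos (n * φ)))
  refine h.congr_deriv ?_
  push_cast
  ring

theorem deriv_deriv_modelH_angle (n : ℕ) (δ ν I φ : ℝ) :
    deriv (deriv (fun φ => modelH n δ ν I φ)) φ =
      -((n : ℝ) ^ 2 * I ^ ((n : ℝ) / 2) * Real.cos (n * φ)) := by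
  rw [funext fun φ => (hasDerivAt_modelH_angle n δ ν I φ).deriv]
  have h := (((hasDerivAt_id φ).const_mul (n : ℝ)).sin).const_mul (-(n * I ^ ((n : ℝ) / 2)))
  refine (h.congr_deriv ?_).deriv
  simp only [id]
  ring

theorem deriv_deriv_modelH_action (n : ℕ) (δ ν φ : ℝ) {I : ℝ} (hI : 0 < I) :
    deriv (deriv (fun I => modelH n δ ν I φ)) I =
      -deriv (fun I => fSigma n (Real.cos (n * φ)) I ν) I := by
  have h : deriv (fun I => modelH n δ ν I φ) =ᶠ[nhds I]
      fun I => δ - fSigma n (Real.cos (n * φ)) I ν := by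
    filter_upwards [lt_mem_nhds hI] with J hJ
    exact (hasDerivAt_modelH_action n δ ν φ hJ).deriv
  rw [h.deriv_eq, deriv_const_sub]

/-- At a critical point `(I₀,φ₀)` of the model Hamiltonian (so `sin(nφ₀)=0`,
`σ = cos(nφ₀) ∈ {±1}` and `δ = f_σ(I₀,ν)`), the mixed second derivative `∂²h/∂I∂φ`
vanishes, the Hessian determinant equals `σ·n²·I₀^(n/2)·∂f_σ/∂I(I₀,ν)`, and the
point is a saddle (negative Hessian determinant) iff `σ·∂f_σ/∂I(I₀,ν) < 0`. -/
theorem stmt_1 (n : ℕ) (hn : 7 ≤ n) (δ ν σ : ℝ) (I₀ φ₀ : ℝ) (hI : 0 < I₀)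
    (hσval : σ = Real.cos (n * φ₀)) (hσ : σ = 1 ∨ σ = -1)
    (hsin : Real.sin (n * φ₀) = 0) (hδ : δ = fSigma n σ I₀ ν) :
    deriv (fun I => deriv (fun φ => modelH n δ ν I φ) φ₀) I₀ = 0 ∧
    deriv (deriv (fun I => modelH n δ ν I φ₀)) I₀ *
        deriv (deriv (fun φ => modelH n δ ν I₀ φ)) φ₀ -
      (deriv (fun I => deriv (fun φ => modelH n δ ν I φ) φ₀) I₀) ^ 2 =
      σ * (n : ℝ) ^ 2 * I₀ ^ ((n : ℝ) / 2) * deriv (fun I => fSigma n σ I ν) I₀ ∧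
    (deriv (deriv (fun I => modelH n δ ν I φ₀)) I₀ *
        deriv (deriv (fun φ => modelH n δ ν I₀ φ)) φ₀ -
      (deriv (fun I => deriv (fun φ => modelH n δ ν I φ) φ₀) I₀) ^ 2 < 0 ↔
      σ * deriv (fun I => fSigma n σ I ν) I₀ < 0) := by
  have hmixed : deriv (fun I => deriv (fun φ => modelH n δ ν I φ) φ₀) I₀ = 0 := by
    simp [(hasDerivAt_modelH_angle n δ ν _ φ₀).deriv, hsin]
  have hdet : deriv (deriv (fun I => modelH n δ ν I φ₀)) I₀ *
        deriv (deriv (fun φ => modelH n δ ν I₀ φ)) φ₀ -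
      (deriv (fun I => deriv (fun φ => modelH n δ ν I φ) φ₀) I₀) ^ 2 =
      σ * (n : ℝ) ^ 2 * I₀ ^ ((n : ℝ) / 2) * deriv (fun I => fSigma n σ I ν) I₀ := by
    rw [hmixed, deriv_deriv_modelH_angle, deriv_deriv_modelH_action n δ ν φ₀ hI, ← hσval]
    ring
  refine ⟨hmixed, hdet, ?_⟩
  have hn0 : (0 : ℝ) < n := by exact_mod_cast (by omega : 0 < n)
  have hpos : 0 < (n : ℝ) ^ 2 * I₀ ^ ((n : ℝ) / 2) := by positivity
  rw [hdet, show σ * (n : ℝ) ^ 2 * I₀ ^ ((n : ℝ) / 2) * deriv (fun I => fSigma n σ I ν) I₀ =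
    (n : ℝ) ^ 2 * I₀ ^ ((n : ℝ) / 2) * (σ * deriv (fun I => fSigma n σ I ν) I₀) by ring]
  exact smul_neg_iff_of_pos_left hpos
end

section
/- Let n ≥ 7 be an integer and σ ∈ {+1, −1}. There exists ε > 0 such that for every ν ∈ (−ε, 0) the function I ↦ f_σ(I, ν) has exactly one critical point I*(ν) in the interval (0, −ν) (i.e. exactly one I ∈ (0,−ν) with ∂f_σ/∂I(I,ν) = 0), and at this point ∂²f_σ/∂I²(I*(ν), ν) < 0, so that I*(ν) is a non-degenerate local maximum of f_σ(·, ν). -/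
/-- The closed form of `∂f_σ/∂I`. -/
noncomputable def fSigmaDeriv (n : ℕ) (σ ν I : ℝ) : ℝ :=
  -2 * ν - 6 * I - σ * ((n : ℝ) / 2) * ((n : ℝ) / 2 - 1) * I ^ ((n : ℝ) / 2 - 2)

/-- The closed form of `∂²f_σ/∂I²`. -/
noncomputable def fSigmaDeriv₂ (n : ℕ) (σ I : ℝ) : ℝ :=
  -6 - σ * ((n : ℝ) / 2 * ((n : ℝ) / 2 - 1) * ((n : ℝ) / 2 - 2) * I ^ ((n : ℝ) / 2 - 3))

theorem hasDerivAt_fSigma (n : ℕ) (σ ν : ℝ) {I : ℝ} (hI : 0 < I) :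
    HasDerivAt (fun I' => fSigma n σ I' ν) (fSigmaDeriv n σ ν I) I := by
  have h := (((hasDerivAt_id I).const_mul (-2 * ν)).sub ((hasDerivAt_pow 2 I).const_mul 3)).sub
    ((Real.hasDerivAt_rpow_const (p := (n : ℝ) / 2 - 1) (Or.inl hI.ne')).const_mul
      (σ * ((n : ℝ) / 2)))
  refine h.congr_deriv ?_
  rw [fSigmaDeriv, show (n : ℝ) / 2 - 1 - 1 = (n : ℝ) / 2 - 2 by ring]
  push_cast
  ring

theorem hasDerivAt_fSigmaDeriv (n : ℕ) (σ ν : ℝ) {I : ℝ} (hI : 0 < I) :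
    HasDerivAt (fSigmaDeriv n σ ν) (fSigmaDeriv₂ n σ I) I := by
  have h := (((hasDerivAt_id I).const_mul 6).const_sub (-2 * ν)).sub
    ((Real.hasDerivAt_rpow_const (p := (n : ℝ) / 2 - 2) (Or.inl hI.ne')).const_mul
      (σ * ((n : ℝ) / 2) * ((n : ℝ) / 2 - 1)))
  refine h.congr_deriv ?_
  rw [fSigmaDeriv₂, show (n : ℝ) / 2 - 2 - 1 = (n : ℝ) / 2 - 3 by ring]
  ring

theorem deriv_deriv_fSigma (n : ℕ) (σ ν : ℝ) {I : ℝ} (hI : 0 < I) :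
    deriv (deriv (fun I' => fSigma n σ I' ν)) I = fSigmaDeriv₂ n σ I := by
  have h : deriv (fun I' => fSigma n σ I' ν) =ᶠ[nhds I] fSigmaDeriv n σ ν := by
    filter_upwards [lt_mem_nhds hI] with J hJ using (hasDerivAt_fSigma n σ ν hJ).deriv
  rw [h.deriv_eq, (hasDerivAt_fSigmaDeriv n σ ν hI).deriv]

theorem continuous_fSigmaDeriv {n : ℕ} (hn : 4 ≤ n) (σ ν : ℝ) :
    Continuous (fSigmaDeriv n σ ν) := by
  have hn' : (4 : ℝ) ≤ n := by exact_mod_cast hn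
  have h := Real.continuous_rpow_const (q := (n : ℝ) / 2 - 2) (by linarith)
  unfold fSigmaDeriv
  fun_prop

theorem exists_forall_mul_rpow_lt_one {C r : ℝ} (hC : 0 < C) (hr : 0 < r) :
    ∃ ε > (0 : ℝ), ∀ x, 0 < x → x < ε → C * x ^ r < 1 := by
  refine ⟨C⁻¹ ^ r⁻¹, by positivity, fun x hx hxε => ?_⟩
  have h := Real.rpow_lt_rpow hx.le hxε hr
  rw [Real.rpow_inv_rpow (by positivity) hr.ne'] at h
  calc C * x ^ r < C * C⁻¹ := by gcongr
    _ = 1 := mul_inv_cancel₀ hC.ne'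

/-- For `n ≥ 7` and `σ = ±1` there is `ε > 0` such that for every `ν ∈ (−ε,0)` the
function `I ↦ f_σ(I,ν)` has exactly one critical point in `(0,−ν)`, and at this
point its second derivative is negative (a non-degenerate local maximum). -/
theorem stmt_2 (n : ℕ) (hn : 7 ≤ n) (σ : ℝ) (hσ : σ = 1 ∨ σ = -1) :
    ∃ ε > (0 : ℝ), ∀ ν ∈ Set.Ioo (-ε) (0 : ℝ),
      (∃! I, I ∈ Set.Ioo (0 : ℝ) (-ν) ∧ deriv (fun I' => fSigma n σ I' ν) I = 0) ∧
      (∀ I ∈ Set.Ioo (0 : ℝ) (-ν), deriv (fun I' => fSigma n σ I' ν) I = 0 →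
        deriv (deriv (fun I' => fSigma n σ I' ν)) I < 0) := by
  have hn' : (7 : ℝ) ≤ n := by exact_mod_cast hn
  have h₁ : 0 < (n : ℝ) / 2 - 1 := by linarith
  have h₂ : 1 ≤ (n : ℝ) / 2 - 2 := by linarith
  have h₃ : 0 < (n : ℝ) / 2 - 3 := by linarith
  obtain ⟨ε, hε, hsmall⟩ := exists_forall_mul_rpow_lt_one
    (C := (n : ℝ) / 2 * ((n : ℝ) / 2 - 1) * ((n : ℝ) / 2 - 2)) (by positivity) h₃
  refine ⟨ε, hε, fun ν hν => ?_⟩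
  obtain ⟨m, rfl⟩ : ∃ m, ν = -m := ⟨-ν, by ring⟩
  rw [neg_neg]
  have hm : 0 < m := by linarith [hν.2]
  have hmε : m < ε := by linarith [hν.1]
  have hneg : ∀ I ∈ Set.Ioo (0 : ℝ) m, fSigmaDeriv₂ n σ I < 0 := by
    intro I hI
    have hpos : 0 < (n : ℝ) / 2 * ((n : ℝ) / 2 - 1) * ((n : ℝ) / 2 - 2)
        * I ^ ((n : ℝ) / 2 - 3) :=
      mul_pos (by positivity) (Real.rpow_pos_of_pos hI.1 _)
    have := hsmall I hI.1 (hI.2.trans hmε)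
    rw [fSigmaDeriv₂]
    rcases hσ with rfl | rfl <;> linarith
  have hcont := continuous_fSigmaDeriv (by lia : 4 ≤ n) σ (-m)
  have hanti : StrictAntiOn (fSigmaDeriv n σ (-m)) (Set.Icc 0 m) := by
    refine strictAntiOn_of_deriv_neg (convex_Icc 0 m) hcont.continuousOn fun I hI => ?_
    rw [interior_Icc] at hI
    rw [(hasDerivAt_fSigmaDeriv n σ (-m) hI.1).deriv]
    exact hneg I hI
  have hleft : 0 < fSigmaDeriv n σ (-m) 0 := by
    rw [fSigmaDeriv, Real.zero_rpow (by linarith)]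
    linarith
  have hright : fSigmaDeriv n σ (-m) m < 0 := by
    have hrpow : m ^ ((n : ℝ) / 2 - 2) = m ^ ((n : ℝ) / 2 - 3) * m := by
      rw [← Real.rpow_add_one hm.ne']
      ring_nf
    have hk : 0 < (n : ℝ) / 2 * ((n : ℝ) / 2 - 1) * m ^ ((n : ℝ) / 2 - 3) :=
      mul_pos (by positivity) (Real.rpow_pos_of_pos hm _)
    have hk₁ : (n : ℝ) / 2 * ((n : ℝ) / 2 - 1) * m ^ ((n : ℝ) / 2 - 3) < 1 := by
      have := hsmall m hm hmε
      nlinarith [mul_le_mul_of_nonneg_left h₂ hk.le]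
    have hb := mul_pos hk hm
    have hb₁ := mul_lt_mul_of_pos_right hk₁ hm
    rw [fSigmaDeriv, hrpow]
    rcases hσ with rfl | rfl <;> linarith
  obtain ⟨I, hI, hI0⟩ := intermediate_value_Ioo' hm.le hcont.continuousOn ⟨hright, hleft⟩
  refine ⟨⟨I, ⟨hI, ?_⟩, ?_⟩, fun J hJ _ => ?_⟩
  · rw [(hasDerivAt_fSigma n σ (-m) hI.1).deriv, hI0]
  · rintro J ⟨hJ, hJ0⟩
    rw [(hasDerivAt_fSigma n σ (-m) hJ.1).deriv] at hJ0
    exact hanti.injOn (Set.Ioo_subset_Icc_self hJ) (Set.Ioo_subset_Icc_self hI)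
      (hJ0.trans hI0.symm)
  · rw [deriv_deriv_fSigma n σ (-m) hJ.1]
    exact hneg J hJ
end

section
/- Let n ≥ 7 be an integer and σ ∈ {+1, −1}, and for small ν < 0 let I*(ν) ∈ (0, −ν) denote the unique critical point of I ↦ f_σ(I, ν) in (0,−ν). Then there exist ε > 0 and C > 0 such that for all ν ∈ (−ε, 0): |I*(ν) − ( −ν/3 − σ·(n/12)·(n/2 − 1)·(−ν/3)^{n/2−2} )| ≤ C·|ν|^{n−5}. -/
theorem abs_rpow_sub_rpow_le {p m x y : ℝ} (hp : 1 ≤ p) (hx : x ∈ Set.Icc 0 m)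
    (hy : y ∈ Set.Icc 0 m) : |x ^ p - y ^ p| ≤ p * m ^ (p - 1) * |x - y| := by
  have h := (convex_Icc (0 : ℝ) m).norm_image_sub_le_of_norm_hasDerivWithin_le
    (f := fun t : ℝ => t ^ p) (f' := fun t : ℝ => p * t ^ (p - 1)) (C := p * m ^ (p - 1))
    (fun t _ => (Real.hasDerivAt_rpow_const (Or.inr hp)).hasDerivWithinAt)
    (fun t ht => by
      have h₀ : 0 ≤ t ^ (p - 1) := Real.rpow_nonneg ht.1 _
      rw [Real.norm_of_nonneg (by positivity)]
      exact mul_le_mul_of_nonneg_left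
        (Real.rpow_le_rpow ht.1 ht.2 (by linarith)) (by linarith)) hy hx
  simpa [Real.norm_eq_abs] using h

/-- If `y = x - A * y ^ p` then `x - A * x ^ p` approximates `y` with an error of
order `m ^ (2 * p - 1)`. -/
theorem abs_sub_first_iterate_le {p m x y A : ℝ} (hp : 1 ≤ p) (hm : 0 < m)
    (hx : x ∈ Set.Icc 0 m) (hy : y ∈ Set.Icc 0 m) (hfix : y = x - A * y ^ p) :
    |y - (x - A * x ^ p)| ≤ A ^ 2 * p * m ^ (2 * p - 1) := by
  have hdist : |x - y| ≤ |A| * m ^ p := by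
    have hxy : x - y = A * y ^ p := by linarith
    rw [hxy, abs_mul, abs_of_nonneg (Real.rpow_nonneg hy.1 p)]
    exact mul_le_mul_of_nonneg_left (Real.rpow_le_rpow hy.1 hy.2 (by linarith)) (abs_nonneg A)
  have herr : y - (x - A * x ^ p) = A * (x ^ p - y ^ p) := by linarith
  have hm' : 0 < m ^ (p - 1) := Real.rpow_pos_of_pos hm _
  calc |y - (x - A * x ^ p)| = |A| * |x ^ p - y ^ p| := by rw [herr, abs_mul]
    _ ≤ |A| * (p * m ^ (p - 1) * |x - y|) := by gcongr; exact abs_rpow_sub_rpow_le hp hx hy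
    _ ≤ |A| * (p * m ^ (p - 1) * (|A| * m ^ p)) := by gcongr
    _ = |A| ^ 2 * p * (m ^ (p - 1) * m ^ p) := by ring
    _ = A ^ 2 * p * m ^ (2 * p - 1) := by
      rw [sq_abs, ← Real.rpow_add hm]
      ring_nf

/-- If, for small `ν < 0`, `I*(ν) ∈ (0,−ν)` is the critical point of `I ↦ f_σ(I,ν)`
(determined by `2ν + 6I + σ·(n/2)·(n/2−1)·I^(n/2−2) = 0`), then
`|I*(ν) − (−ν/3 − σ·(n/12)·(n/2−1)·(−ν/3)^(n/2−2))| ≤ C·|ν|^(n−5)`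
for all sufficiently small `ν < 0`. -/
theorem stmt_3 (n : ℕ) (hn : 7 ≤ n) (σ : ℝ) (hσ : σ = 1 ∨ σ = -1)
    (Istar : ℝ → ℝ) (ε₀ : ℝ) (hε₀ : 0 < ε₀)
    (hcrit : ∀ ν ∈ Set.Ioo (-ε₀) (0 : ℝ),
      Istar ν ∈ Set.Ioo (0 : ℝ) (-ν) ∧
      2 * ν + 6 * Istar ν +
        σ * ((n : ℝ) / 2) * ((n : ℝ) / 2 - 1) * (Istar ν) ^ ((n : ℝ) / 2 - 2) = 0) :
    ∃ ε > (0 : ℝ), ∃ C > (0 : ℝ), ∀ ν ∈ Set.Ioo (-ε) (0 : ℝ),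
      |Istar ν -
        (-ν / 3 - σ * ((n : ℝ) / 12) * ((n : ℝ) / 2 - 1) * (-ν / 3) ^ ((n : ℝ) / 2 - 2))| ≤
      C * |ν| ^ (n - 5) := by
  have hn' : (7 : ℝ) ≤ n := by exact_mod_cast hn
  set p : ℝ := (n : ℝ) / 2 - 2 with hp_def
  have hp : 1 ≤ p := by linarith
  set A : ℝ := σ * ((n : ℝ) / 12) * ((n : ℝ) / 2 - 1) with hA_def
  have hA : 0 < A ^ 2 := by
    have hσ₀ : σ ≠ 0 := by rcases hσ with rfl | rfl <;> norm_num
    have hn₁ : (n : ℝ) / 12 ≠ 0 := by linarith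
    have hn₂ : (n : ℝ) / 2 - 1 ≠ 0 := by linarith
    positivity
  refine ⟨ε₀, hε₀, A ^ 2 * p, by positivity, fun ν hν => ?_⟩
  obtain ⟨⟨hI₀, hI₁⟩, hI⟩ := hcrit ν hν
  have hν₀ : ν < 0 := hν.2
  have hpow : |ν| ^ (n - 5) = (-ν) ^ (2 * p - 1) := by
    rw [abs_of_neg hν₀, ← Real.rpow_natCast, Nat.cast_sub (by linarith), hp_def]
    congr 1
    push_cast
    ring
  rw [hpow]
  refine abs_sub_first_iterate_le hp (by linarith) ⟨by linarith, by linarith⟩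
    ⟨hI₀.le, hI₁.le⟩ ?_
  rw [hA_def]
  linarith
end

section
/- Let n ≥ 7 be an integer and σ ∈ {+1, −1}, and for small ν < 0 let I*(ν) ∈ (0, −ν) be the unique critical point of I ↦ f_σ(I, ν) in (0,−ν), and set δ_σ(ν) = f_σ(I*(ν), ν). Then there exist ε > 0 and C > 0 such that for all ν ∈ (−ε, 0): |δ_σ(ν) − ( ν²/3 − σ·(n/2)·(−ν/3)^{n/2−1} )| ≤ C·|ν|^{n−4}; moreover, after possibly shrinking ε, δ_{+1}(ν) < δ_{−1}(ν) for all ν ∈ (−ε, 0). -/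
/-- On `(0, x)` the function `y ↦ y ^ (a + 1)` is Lipschitz with constant `(a + 1) x ^ a`. -/
lemma abs_rpow_add_one_sub_le {a x u v : ℝ} (ha : 0 ≤ a) (hu : u ∈ Set.Ioo 0 x)
    (hv : v ∈ Set.Ioo 0 x) :
    |u ^ (a + 1) - v ^ (a + 1)| ≤ (a + 1) * x ^ a * |u - v| := by
  have hderiv : ∀ y ∈ Set.Ioo 0 x,
      HasDerivWithinAt (fun t : ℝ => t ^ (a + 1)) ((a + 1) * y ^ a) (Set.Ioo 0 x) y := by
    intro y hy
    have h := (Real.hasDerivAt_rpow_const (x := y) (p := a + 1)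
      (Or.inl hy.1.ne')).hasDerivWithinAt (s := Set.Ioo 0 x)
    rwa [add_sub_cancel_right] at h
  have hbound : ∀ y ∈ Set.Ioo 0 x, ‖(a + 1) * y ^ a‖ ≤ (a + 1) * x ^ a := by
    intro y hy
    have hpow : 0 ≤ y ^ a := Real.rpow_nonneg hy.1.le a
    rw [Real.norm_eq_abs, abs_of_nonneg (by positivity)]
    have := Real.rpow_le_rpow hy.1.le hy.2.le ha
    gcongr
  simpa only [Real.norm_eq_abs] using
    (convex_Ioo 0 x).norm_image_sub_le_of_norm_hasDerivWithin_le hderiv hbound hv hu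

/-- The value of `f_σ(·,ν)` after completing the square in its quadratic part. -/
lemma fSigma_eq (n : ℕ) (σ I ν : ℝ) :
    fSigma n σ I ν =
      ν ^ 2 / 3 - 3 * (I + ν / 3) ^ 2 - σ * ((n : ℝ) / 2) * I ^ ((n : ℝ) / 2 - 1) := by
  unfold fSigma
  ring

/-- The expansion of the critical value of `f_σ(·,ν)`, with an explicit constant. -/
lemma abs_fSigma_sub_le {n : ℕ} (hn : 4 ≤ n) {σ I ν : ℝ} (hσ : |σ| = 1)
    (hI : I ∈ Set.Ioo 0 (-ν))
    (hcrit : 2 * ν + 6 * I +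
      σ * ((n : ℝ) / 2) * ((n : ℝ) / 2 - 1) * I ^ ((n : ℝ) / 2 - 2) = 0) :
    |fSigma n σ I ν -
        (ν ^ 2 / 3 - σ * ((n : ℝ) / 2) * (-ν / 3) ^ ((n : ℝ) / 2 - 1))| ≤
      ((n : ℝ) / 2 * ((n : ℝ) / 2 - 1)) ^ 2 / 4 * |ν| ^ (n - 4) := by
  obtain ⟨hI0, hIν⟩ := hI
  have hn' : (4 : ℝ) ≤ n := by exact_mod_cast hn
  set h : ℝ := (n : ℝ) / 2 with hh
  set a : ℝ := h - 2 with ha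
  have ha0 : 0 ≤ a := by linarith
  have hν : 0 < -ν := hI0.trans hIν
  have hexp : h - 1 = a + 1 := by rw [ha]; ring
  set X : ℝ := (-ν) ^ a with hX
  have hX0 : 0 ≤ X := Real.rpow_nonneg hν.le a
  have hIX : I ^ a ≤ X := Real.rpow_le_rpow hI0.le hIν.le ha0
  have hIa : 0 ≤ I ^ a := Real.rpow_nonneg hI0.le a
  have hXX : |ν| ^ (n - 4) = X ^ 2 := by
    rw [abs_of_neg (by linarith), hX, ← Real.rpow_natCast, ← Real.rpow_mul_natCast hν.le,
      Nat.cast_sub hn]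
    congr 1
    rw [ha, hh]
    push_cast
    ring
  have hdist : |I - -ν / 3| ≤ h * (a + 1) / 6 * X := by
    have heq : I - -ν / 3 = -σ * (h * (a + 1) / 6 * I ^ a) := by
      rw [hexp] at hcrit
      linarith
    rw [heq, abs_mul, abs_neg, hσ, one_mul, abs_of_nonneg (by positivity)]
    gcongr
  have hpow := abs_rpow_add_one_sub_le ha0 ⟨hI0, hIν⟩
    (⟨by linarith, by linarith⟩ : -ν / 3 ∈ Set.Ioo 0 (-ν))
  rw [fSigma_eq, ← hh, hexp, hXX]
  have hsplit : ν ^ 2 / 3 - 3 * (I + ν / 3) ^ 2 - σ * h * I ^ (a + 1) -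
      (ν ^ 2 / 3 - σ * h * (-ν / 3) ^ (a + 1)) =
      -(3 * (I - -ν / 3) ^ 2) - σ * (h * (I ^ (a + 1) - (-ν / 3) ^ (a + 1))) := by ring
  have hh0 : 0 ≤ h := by positivity
  rw [hsplit]
  calc _ ≤ |-(3 * (I - -ν / 3) ^ 2)| + |σ * (h * (I ^ (a + 1) - (-ν / 3) ^ (a + 1)))| :=
        abs_sub _ _
    _ = 3 * |I - -ν / 3| ^ 2 + h * |I ^ (a + 1) - (-ν / 3) ^ (a + 1)| := by
        rw [abs_neg, abs_mul, abs_mul, abs_mul, hσ, abs_of_nonneg hh0, abs_pow, one_mul,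
          abs_of_pos (by norm_num : (0 : ℝ) < 3)]
    _ ≤ 3 * (h * (a + 1) / 6 * X) ^ 2 + h * ((a + 1) * X * (h * (a + 1) / 6 * X)) := by
        gcongr
        exact hpow.trans (by gcongr)
    _ = (h * (a + 1)) ^ 2 / 4 * X ^ 2 := by ring

/-- The critical value of `f₊₁(·,ν)` lies strictly below `ν²/3`. -/
lemma fSigma_one_lt {n : ℕ} (hn : 0 < n) {I : ℝ} (ν : ℝ) (hI : 0 < I) :
    fSigma n 1 I ν < ν ^ 2 / 3 := by
  have : 0 < (n : ℝ) / 2 * I ^ ((n : ℝ) / 2 - 1) := by positivity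
  rw [fSigma_eq]
  nlinarith [sq_nonneg (I + ν / 3)]

/-- The critical value of `f₋₁(·,ν)` lies strictly above `ν²/3` if the critical point is small. -/
lemma lt_fSigma_neg_one {n : ℕ} {I ν : ℝ} (hI : 0 < I)
    (hcrit : 2 * ν + 6 * I +
      -1 * ((n : ℝ) / 2) * ((n : ℝ) / 2 - 1) * I ^ ((n : ℝ) / 2 - 2) = 0)
    (hsmall : ((n : ℝ) / 2 * ((n : ℝ) / 2 - 1)) ^ 2 * I ^ ((n : ℝ) / 2 - 3) < 12 * ((n : ℝ) / 2)) :
    ν ^ 2 / 3 < fSigma n (-1) I ν := by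
  set h : ℝ := (n : ℝ) / 2 with hh
  have hp2 : I ^ (h - 2) = I ^ (h - 3) * I := by
    rw [← Real.rpow_add_one hI.ne']
    ring_nf
  have hp1 : I ^ (h - 1) = I ^ (h - 3) * I * I := by
    rw [← hp2, ← Real.rpow_add_one hI.ne']
    ring_nf
  have hpos : 0 < I ^ (h - 3) * I * I := by positivity
  have hdist : I + ν / 3 = h * (h - 1) / 6 * (I ^ (h - 3) * I) := by
    rw [hp2] at hcrit
    linarith
  have hmul := mul_lt_mul_of_pos_right hsmall hpos
  rw [fSigma_eq, ← hh, hdist, hp1]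
  linarith

/-- If for `σ = ±1` and small `ν < 0`, `I*(σ,ν) ∈ (0,−ν)` is the critical point of
`I ↦ f_σ(I,ν)` (determined by `2ν + 6I + σ·(n/2)·(n/2−1)·I^(n/2−2) = 0`) and
`δ_σ(ν) = f_σ(I*(σ,ν),ν)` is the critical value, then
`|δ_σ(ν) − (ν²/3 − σ·(n/2)·(−ν/3)^(n/2−1))| ≤ C·|ν|^(n−4)` for small `ν < 0`;
moreover `δ₊₁(ν) < δ₋₁(ν)` for all sufficiently small `ν < 0`. -/
theorem stmt_4 (n : ℕ) (hn : 7 ≤ n)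
    (Istar : ℝ → ℝ → ℝ) (ε₀ : ℝ) (hε₀ : 0 < ε₀)
    (hcrit : ∀ σ : ℝ, σ = 1 ∨ σ = -1 → ∀ ν ∈ Set.Ioo (-ε₀) (0 : ℝ),
      Istar σ ν ∈ Set.Ioo (0 : ℝ) (-ν) ∧
      2 * ν + 6 * Istar σ ν +
        σ * ((n : ℝ) / 2) * ((n : ℝ) / 2 - 1) * (Istar σ ν) ^ ((n : ℝ) / 2 - 2) = 0) :
    ∃ ε > (0 : ℝ), ∃ C > (0 : ℝ), ∀ ν ∈ Set.Ioo (-ε) (0 : ℝ),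
      (∀ σ : ℝ, σ = 1 ∨ σ = -1 →
        |fSigma n σ (Istar σ ν) ν -
          (ν ^ 2 / 3 - σ * ((n : ℝ) / 2) * (-ν / 3) ^ ((n : ℝ) / 2 - 1))| ≤
        C * |ν| ^ (n - 4)) ∧
      fSigma n 1 (Istar 1 ν) ν < fSigma n (-1) (Istar (-1) ν) ν := by
  have hn' : (7 : ℝ) ≤ n := by exact_mod_cast hn
  set K : ℝ := (n : ℝ) / 2 * ((n : ℝ) / 2 - 1) with hK
  have hK0 : 0 < K := mul_pos (by linarith) (by linarith)
  have hb : 0 < (n : ℝ) / 2 - 3 := by linarith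
  set c : ℝ := 12 * ((n : ℝ) / 2) / K ^ 2 with hc
  have hc0 : 0 < c := by positivity
  refine ⟨min ε₀ (c ^ ((n : ℝ) / 2 - 3)⁻¹), lt_min hε₀ (Real.rpow_pos_of_pos hc0 _),
    K ^ 2 / 4, by positivity, fun ν hν => ?_⟩
  have hνε : ν ∈ Set.Ioo (-ε₀) 0 :=
    ⟨(neg_le_neg (min_le_left _ _)).trans_lt hν.1, hν.2⟩
  refine ⟨fun σ hσ => ?_, ?_⟩
  · obtain ⟨hI, hcr⟩ := hcrit σ hσ ν hνε
    exact abs_fSigma_sub_le (by omega) (by rcases hσ with rfl | rfl <;> simp) hI hcr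
  · obtain ⟨hI, hcr⟩ := hcrit (-1) (Or.inr rfl) ν hνε
    refine (fSigma_one_lt (by omega) ν (hcrit 1 (Or.inl rfl) ν hνε).1.1).trans
      (lt_fSigma_neg_one hI.1 hcr ?_)
    have hIc : Istar (-1) ν < c ^ ((n : ℝ) / 2 - 3)⁻¹ := by
      have := hν.1
      have := min_le_right ε₀ (c ^ ((n : ℝ) / 2 - 3)⁻¹)
      linarith [hI.2]
    have hlt := Real.rpow_lt_rpow hI.1.le hIc hb
    rwa [Real.rpow_inv_rpow hc0.le hb.ne', hc, lt_div_iff₀' (by positivity)] at hlt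
end

section
/- Let n ≥ 7 be an integer. There exists a constant C > 0 (depending only on n) such that for all ε, μ with 0 < ε ≤ μ and ε ≤ 1, all J with |J| ≤ 1/2 and all φ ∈ ℝ, the rescaled Hamiltonian h̄(J,φ) := ε^{−n/2}·( h(ε + ε^{n/4}μ^{−1/2}J, φ) − (δε + νε² + ε³) ) with δ = 3ε² − 2με and ν = μ − 3ε satisfies |h̄(J,φ) − (J² + cos(nφ))| ≤ C·ε^{(n−6)/4}. -/
/-- For `|y| ≤ 2`, the power `y ^ k` is within `2 ^ k * |y - 1|` of `1`. -/
theorem abs_pow_sub_one_le_two_pow_mul {y : ℝ} (hy : |y| ≤ 2) (k : ℕ) :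
    |y ^ k - 1| ≤ 2 ^ k * |y - 1| := by
  induction k with
  | zero => simp
  | succ k ih =>
    have hk : |y ^ k| ≤ 2 ^ k := by
      rw [abs_pow]
      gcongr
    calc |y ^ (k + 1) - 1| = |y ^ k * (y - 1) + (y ^ k - 1)| := by ring_nf
      _ ≤ |y ^ k * (y - 1)| + |y ^ k - 1| := abs_add_le _ _
      _ ≤ 2 ^ k * |y - 1| + 2 ^ k * |y - 1| := by
        rw [abs_mul]
        gcongr
      _ = 2 ^ (k + 1) * |y - 1| := by ring

/-- For `0 ≤ y ≤ 2`, the half-integer power `y ^ (n / 2)` is within `2 ^ n * |y - 1|` of `1`. -/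
theorem abs_rpow_half_sub_one_le {y : ℝ} (hy₀ : 0 ≤ y) (hy : y ≤ 2) (n : ℕ) :
    |y ^ ((n : ℝ) / 2) - 1| ≤ 2 ^ n * |y - 1| := by
  have hu : 0 ≤ y ^ ((n : ℝ) / 2) := Real.rpow_nonneg hy₀ _
  have hsq : (y ^ ((n : ℝ) / 2)) ^ 2 = y ^ n := by
    rw [← Real.rpow_mul_natCast hy₀, ← Real.rpow_natCast]
    congr 1
    push_cast
    ring
  calc |y ^ ((n : ℝ) / 2) - 1|
      ≤ |y ^ ((n : ℝ) / 2) - 1| * (y ^ ((n : ℝ) / 2) + 1) :=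
        le_mul_of_one_le_right (abs_nonneg _) (by linarith)
    _ = |(y ^ ((n : ℝ) / 2)) ^ 2 - 1| := by
        rw [show ∀ u : ℝ, u ^ 2 - 1 = (u + 1) * (u - 1) by intro u; ring, abs_mul,
          abs_of_nonneg (show 0 ≤ y ^ ((n : ℝ) / 2) + 1 by linarith), mul_comm]
    _ ≤ 2 ^ n * |y - 1| := by
        rw [hsq]
        exact abs_pow_sub_one_le_two_pow_mul (abs_le.2 ⟨by linarith, hy⟩) n

/-- For `n ≥ 7` there is `C > 0` (depending only on `n`) such that for all
`0 < ε ≤ μ`, `ε ≤ 1`, `|J| ≤ 1/2` and `φ`, the rescaled Hamiltonian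
`h̄(J,φ) = ε^(−n/2)(h(ε + ε^(n/4)μ^(−1/2)J, φ) − (δε + νε² + ε³))` with
`δ = 3ε² − 2με`, `ν = μ − 3ε` satisfies
`|h̄(J,φ) − (J² + cos(nφ))| ≤ C·ε^((n−6)/4)`. -/
theorem stmt_6 (n : ℕ) (hn : 7 ≤ n) :
    ∃ C > (0 : ℝ), ∀ ε μ J φ : ℝ, 0 < ε → ε ≤ μ → ε ≤ 1 → |J| ≤ 1 / 2 →
      |ε ^ (-(n : ℝ) / 2) *
          (modelH n (3 * ε ^ 2 - 2 * μ * ε) (μ - 3 * ε)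
              (ε + ε ^ ((n : ℝ) / 4) * μ ^ (-(1 : ℝ) / 2) * J) φ -
            ((3 * ε ^ 2 - 2 * μ * ε) * ε + (μ - 3 * ε) * ε ^ 2 + ε ^ 3)) -
        (J ^ 2 + Real.cos (n * φ))| ≤ C * ε ^ (((n : ℝ) - 6) / 4) := by
  refine ⟨2 ^ n + 1, by positivity, fun ε μ J φ hε hεμ hε1 hJ => ?_⟩
  have hμ : 0 < μ := hε.trans_le hεμ
  have hn' : (7 : ℝ) ≤ n := by exact_mod_cast hn
  obtain ⟨r, hr⟩ : ∃ r, r = ε ^ (((n : ℝ) - 6) / 4) := ⟨_, rfl⟩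
  obtain ⟨m, hm⟩ : ∃ m, m = μ ^ (-(1 : ℝ) / 2) := ⟨_, rfl⟩
  have hr0 : 0 < r := hr ▸ Real.rpow_pos_of_pos hε _
  have hr1 : r ≤ 1 := hr ▸ Real.rpow_le_one hε.le hε1 (by linarith)
  have hm0 : 0 < m := hm ▸ Real.rpow_pos_of_pos hμ _
  have hs0 : 0 < √ε := Real.sqrt_pos.2 hε
  have hs : √ε ^ 2 = ε := Real.sq_sqrt hε.le
  have hmμ : μ * m ^ 2 = 1 := by
    rw [hm, ← Real.rpow_mul_natCast hμ.le]
    norm_num [Real.rpow_neg_one, hμ.ne']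
  have ha : ε ^ ((n : ℝ) / 4) = r * √ε ^ 3 := by
    rw [hr, Real.sqrt_eq_rpow, ← Real.rpow_mul_natCast hε.le, ← Real.rpow_add hε]
    congr 1
    push_cast
    ring
  have hb : ε ^ ((n : ℝ) / 2) = (r * √ε ^ 3) ^ 2 := by
    rw [← ha, ← Real.rpow_mul_natCast hε.le]
    congr 1
    push_cast
    ring
  have hp1 : √ε * m ≤ 1 := by
    refine (sq_le_one_iff₀ (by positivity)).1 ?_
    rw [mul_pow, hs, ← hmμ]
    gcongr
  obtain ⟨t, ht⟩ : ∃ t, t = r * (√ε * m) * J := ⟨_, rfl⟩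
  have htr : |t| ≤ r := by
    rw [ht, abs_mul, abs_of_pos (by positivity)]
    calc r * (√ε * m) * |J| ≤ r * 1 * 1 := by
          gcongr
          linarith
      _ = r := by ring
  have ht2 : |t| ≤ 1 / 2 := by
    rw [ht, abs_mul, abs_of_pos (by positivity)]
    calc r * (√ε * m) * |J| ≤ 1 * 1 * (1 / 2) := by gcongr
      _ = 1 / 2 := by ring
  obtain ⟨ht₁, ht₂⟩ := abs_le.1 ht2
  have hx : ε + ε ^ ((n : ℝ) / 4) * m * J = ε * (1 + t) := by
    rw [ha, ht]
    linear_combination (r * √ε * m * J) * hs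
  have hpow : (ε * (1 + t)) ^ ((n : ℝ) / 2) =
      (r * √ε ^ 3) ^ 2 * (1 + t) ^ ((n : ℝ) / 2) := by
    rw [Real.mul_rpow hε.le (by linarith), hb]
  have hq : |(1 + t) ^ ((n : ℝ) / 2) - 1| ≤ 2 ^ n * r := by
    refine (abs_rpow_half_sub_one_le (by linarith) (by linarith) n).trans ?_
    rw [add_sub_cancel_left]
    gcongr
  have hcubic : |r * (√ε * m) ^ 3 * J ^ 3| ≤ r := by
    rw [abs_mul, abs_of_pos (by positivity), abs_pow]
    calc r * (√ε * m) ^ 3 * |J| ^ 3 ≤ r * 1 ^ 3 * 1 ^ 3 := by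
          gcongr
          linarith
      _ = r := by ring
  rw [← hm, ← hr, hx, modelH, hpow, neg_div, Real.rpow_neg hε.le, hb]
  have key : ((r * √ε ^ 3) ^ 2)⁻¹ *
      ((3 * ε ^ 2 - 2 * μ * ε) * (ε * (1 + t)) + (μ - 3 * ε) * (ε * (1 + t)) ^ 2 +
          (ε * (1 + t)) ^ 3 + (r * √ε ^ 3) ^ 2 * (1 + t) ^ ((n : ℝ) / 2) * Real.cos (n * φ) -
        ((3 * ε ^ 2 - 2 * μ * ε) * ε + (μ - 3 * ε) * ε ^ 2 + ε ^ 3)) -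
      (J ^ 2 + Real.cos (n * φ)) =
      r * (√ε * m) ^ 3 * J ^ 3 + ((1 + t) ^ ((n : ℝ) / 2) - 1) * Real.cos (n * φ) := by
    have hpoly : (3 * ε ^ 2 - 2 * μ * ε) * (ε * (1 + t)) + (μ - 3 * ε) * (ε * (1 + t)) ^ 2 +
          (ε * (1 + t)) ^ 3 - ((3 * ε ^ 2 - 2 * μ * ε) * ε + (μ - 3 * ε) * ε ^ 2 + ε ^ 3) =
        (r * √ε ^ 3) ^ 2 * (J ^ 2 + r * (√ε * m) ^ 3 * J ^ 3) := by
      have h1 : ε * t = r * √ε ^ 3 * m * J := by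
        rw [ht]
        linear_combination -(r * √ε * m * J) * hs
      calc _ = μ * (ε * t) ^ 2 + (ε * t) ^ 3 := by ring
        _ = _ := by
          rw [h1]
          linear_combination (r * √ε ^ 3) ^ 2 * J ^ 2 * hmμ
    rw [sub_eq_iff_eq_add, inv_mul_eq_iff_eq_mul₀ (by positivity)]
    linear_combination hpoly
  rw [key]
  calc _ ≤ |r * (√ε * m) ^ 3 * J ^ 3| + |((1 + t) ^ ((n : ℝ) / 2) - 1) * Real.cos (n * φ)| :=
        abs_add_le _ _
    _ ≤ r + 2 ^ n * r * 1 := by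
        rw [abs_mul (_ - _)]
        gcongr
        exact Real.abs_cos_le_one _
    _ = (2 ^ n + 1) * r := by ring
end

section
/- Let a be real and consider h̄(J,φ) = aJ + J² + J^{5/2}·cos(5φ) for J > 0 and φ ∈ [0, 2π). Call a critical point of h̄ a saddle if the determinant of the Hessian of h̄ there is negative. Then the number of saddle critical points (J,φ) with J > 0 and φ ∈ [0, 2π) equals: 5 if a > 0; 10 if −128/675 < a < 0; and 5 if a < −128/675. -/
/-- The rescaled `n = 5` model Hamiltonian `h̄(J,φ) = aJ + J² + J^(5/2)·cos(5φ)`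
(real power). -/
noncomputable def hbar5 (a J φ : ℝ) : ℝ :=
  a * J + J ^ 2 + J ^ ((5 : ℝ) / 2) * Real.cos (5 * φ)

/-- The set of saddle critical points of `h̄` with `J > 0` and `φ ∈ [0,2π)`:
critical points at which the Hessian determinant is negative. -/
noncomputable def saddleSet5 (a : ℝ) : Set (ℝ × ℝ) :=
  {p | 0 < p.1 ∧ p.2 ∈ Set.Ico (0 : ℝ) (2 * Real.pi) ∧
    deriv (fun J => hbar5 a J p.2) p.1 = 0 ∧
    deriv (fun φ => hbar5 a p.1 φ) p.2 = 0 ∧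
    deriv (deriv (fun J => hbar5 a J p.2)) p.1 *
        deriv (deriv (fun φ => hbar5 a p.1 φ)) p.2 -
      (deriv (fun J => deriv (fun φ => hbar5 a J φ) p.2) p.1) ^ 2 < 0}

theorem hasDerivAt_hbar5_action (a J φ : ℝ) :
    HasDerivAt (fun J => hbar5 a J φ)
      (a + 2 * J + 5 / 2 * J ^ ((3 : ℝ) / 2) * Real.cos (5 * φ)) J := by
  have h := (((hasDerivAt_id J).const_mul a).add (hasDerivAt_pow 2 J)).add
    ((Real.hasDerivAt_rpow_const (x := J) (p := (5 : ℝ) / 2) (Or.inr (by norm_num))).mul_const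
      (Real.cos (5 * φ)))
  refine h.congr_deriv ?_
  norm_num

theorem hasDerivAt_deriv_hbar5_action (a J φ : ℝ) :
    HasDerivAt (deriv (fun J => hbar5 a J φ))
      (2 + 15 / 4 * J ^ ((1 : ℝ) / 2) * Real.cos (5 * φ)) J := by
  have hd : deriv (fun J => hbar5 a J φ) =
      fun J => a + 2 * J + 5 / 2 * J ^ ((3 : ℝ) / 2) * Real.cos (5 * φ) :=
    funext fun J => (hasDerivAt_hbar5_action a J φ).deriv
  rw [hd]
  have h := (((hasDerivAt_id J).const_mul 2).const_add a).add
    (((Real.hasDerivAt_rpow_const (x := J) (p := (3 : ℝ) / 2)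
      (Or.inr (by norm_num))).const_mul (5 / 2)).mul_const (Real.cos (5 * φ)))
  refine h.congr_deriv ?_
  rw [show (3 : ℝ) / 2 - 1 = 1 / 2 by norm_num]
  ring

theorem hasDerivAt_hbar5_angle (a J φ : ℝ) :
    HasDerivAt (fun φ => hbar5 a J φ) (-5 * J ^ ((5 : ℝ) / 2) * Real.sin (5 * φ)) φ := by
  have h := ((((hasDerivAt_id φ).const_mul 5).cos).const_mul (J ^ ((5 : ℝ) / 2))).const_add
    (a * J + J ^ 2)
  refine h.congr_deriv ?_
  simp only [id]
  ring

theorem hasDerivAt_deriv_hbar5_angle (a J φ : ℝ) :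
    HasDerivAt (deriv (fun φ => hbar5 a J φ))
      (-25 * J ^ ((5 : ℝ) / 2) * Real.cos (5 * φ)) φ := by
  have hd : deriv (fun φ => hbar5 a J φ) =
      fun φ => -5 * J ^ ((5 : ℝ) / 2) * Real.sin (5 * φ) :=
    funext fun φ => (hasDerivAt_hbar5_angle a J φ).deriv
  rw [hd]
  have h := (((hasDerivAt_id φ).const_mul 5).sin).const_mul (-5 * J ^ ((5 : ℝ) / 2))
  refine h.congr_deriv ?_
  simp only [id]
  ring

theorem hasDerivAt_deriv_hbar5_mixed (J φ : ℝ) :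
    HasDerivAt (fun J : ℝ => -5 * J ^ ((5 : ℝ) / 2) * Real.sin (5 * φ))
      (-25 / 2 * J ^ ((3 : ℝ) / 2) * Real.sin (5 * φ)) J := by
  have h := ((Real.hasDerivAt_rpow_const (x := J) (p := (5 : ℝ) / 2)
      (Or.inr (by norm_num))).const_mul (-5)).mul_const (Real.sin (5 * φ))
  refine h.congr_deriv ?_
  rw [show (5 : ℝ) / 2 - 1 = 3 / 2 by norm_num]
  ring

theorem sq_rpow_div_two {s : ℝ} (hs : 0 ≤ s) (n : ℕ) : (s ^ 2) ^ ((n : ℝ) / 2) = s ^ n := by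
  rw [← Real.rpow_natCast s 2, ← Real.rpow_mul hs, ← Real.rpow_natCast s n]
  congr 1
  push_cast
  ring

/-- The actions of the saddles on the rays `cos (5φ) = 1`. -/
def saddleActionsPos (a : ℝ) : Set ℝ :=
  (fun s => s ^ 2) '' {s | 0 < s ∧ a + 2 * s ^ 2 + 5 / 2 * s ^ 3 = 0}

/-- The actions of the saddles on the rays `cos (5φ) = -1`. -/
def saddleActionsNeg (a : ℝ) : Set ℝ :=
  (fun s => s ^ 2) '' {s | 8 / 15 < s ∧ a + 2 * s ^ 2 - 5 / 2 * s ^ 3 = 0}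

/-- The angles in `[0, 2π)` at which `5φ` agrees with `c` modulo `2π`. -/
def fivefoldAngles (c : ℝ) : Set ℝ :=
  {φ | φ ∈ Set.Ico 0 (2 * Real.pi) ∧ ∃ k : ℤ, c + k * (2 * Real.pi) = 5 * φ}

theorem sq_mem_saddleActionsPos {a s : ℝ} (hs : 0 < s) :
    s ^ 2 ∈ saddleActionsPos a ↔ a + 2 * s ^ 2 + 5 / 2 * s ^ 3 = 0 := by
  refine ⟨?_, fun h => ⟨s, ⟨hs, h⟩, rfl⟩⟩
  rintro ⟨t, ⟨ht, h⟩, hts⟩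
  obtain rfl : t = s := (pow_left_inj₀ ht.le hs.le two_ne_zero).1 hts
  exact h

theorem sq_mem_saddleActionsNeg {a s : ℝ} (hs : 0 < s) :
    s ^ 2 ∈ saddleActionsNeg a ↔ 8 / 15 < s ∧ a + 2 * s ^ 2 - 5 / 2 * s ^ 3 = 0 := by
  refine ⟨?_, fun h => ⟨s, h, rfl⟩⟩
  rintro ⟨t, ⟨ht, h⟩, hts⟩
  obtain rfl : t = s := (pow_left_inj₀ (by linarith) hs.le two_ne_zero).1 hts
  exact ⟨ht, h⟩

theorem mem_fivefoldAngles_zero {φ : ℝ} :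
    φ ∈ fivefoldAngles 0 ↔ φ ∈ Set.Ico 0 (2 * Real.pi) ∧ Real.cos (5 * φ) = 1 := by
  simp [fivefoldAngles, Real.cos_eq_one_iff]

theorem mem_fivefoldAngles_pi {φ : ℝ} :
    φ ∈ fivefoldAngles Real.pi ↔ φ ∈ Set.Ico 0 (2 * Real.pi) ∧ Real.cos (5 * φ) = -1 := by
  simp [fivefoldAngles, Real.cos_eq_neg_one_iff]

theorem sq_mem_saddleSet5 {a s φ : ℝ} (hs : 0 < s) :
    (s ^ 2, φ) ∈ saddleSet5 a ↔ φ ∈ Set.Ico 0 (2 * Real.pi) ∧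
      (Real.cos (5 * φ) = 1 ∧ a + 2 * s ^ 2 + 5 / 2 * s ^ 3 = 0 ∨
        Real.cos (5 * φ) = -1 ∧ 8 / 15 < s ∧ a + 2 * s ^ 2 - 5 / 2 * s ^ 3 = 0) := by
  have h5 : (s ^ 2) ^ ((5 : ℝ) / 2) = s ^ 5 := mod_cast sq_rpow_div_two hs.le 5
  have h3 : (s ^ 2) ^ ((3 : ℝ) / 2) = s ^ 3 := mod_cast sq_rpow_div_two hs.le 3
  have h1 : (s ^ 2) ^ ((1 : ℝ) / 2) = s := by simpa using sq_rpow_div_two hs.le 1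
  simp only [saddleSet5, Set.mem_ofPred_eq, (hasDerivAt_hbar5_action _ _ _).deriv,
    (hasDerivAt_deriv_hbar5_action _ _ _).deriv, (hasDerivAt_deriv_hbar5_angle _ _ _).deriv,
    (hasDerivAt_deriv_hbar5_mixed _ _).deriv, (hasDerivAt_hbar5_angle _ _ _).deriv, h5, h3, h1]
  have hs5 : 0 < s ^ 5 := by positivity
  constructor
  · rintro ⟨-, hφ, hJ, hsin, hdet⟩
    have hsin0 : Real.sin (5 * φ) = 0 := by
      rcases mul_eq_zero.1 hsin with h | h
      · linarith
      · exact h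
    rw [hsin0] at hdet
    refine ⟨hφ, ?_⟩
    rcases Real.sin_eq_zero_iff_cos_eq.1 hsin0 with h | h <;> rw [h] at hJ hdet
    · exact Or.inl ⟨h, by linarith⟩
    · refine Or.inr ⟨h, ?_, by linarith⟩
      by_contra! hle
      nlinarith [mul_nonneg hs5.le (sub_nonneg.2 hle)]
  · rintro ⟨hφ, ⟨h, hJ⟩ | ⟨h, hlt, hJ⟩⟩
    · have hsin0 := Real.sin_eq_zero_iff_cos_eq.2 (Or.inl h)
      rw [h, hsin0]
      refine ⟨by positivity, hφ, by linarith, by ring, ?_⟩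
      nlinarith [mul_pos hs5 hs]
    · have hsin0 := Real.sin_eq_zero_iff_cos_eq.2 (Or.inr h)
      rw [h, hsin0]
      refine ⟨by positivity, hφ, by linarith, by ring, ?_⟩
      nlinarith [mul_pos hs5 (sub_pos.2 hlt)]

theorem saddleSet5_eq (a : ℝ) :
    saddleSet5 a = saddleActionsPos a ×ˢ fivefoldAngles 0 ∪
      saddleActionsNeg a ×ˢ fivefoldAngles Real.pi := by
  ext ⟨J, φ⟩
  by_cases hJ : 0 < J
  · obtain ⟨s, hs, rfl⟩ : ∃ s : ℝ, 0 < s ∧ s ^ 2 = J :=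
      ⟨√J, Real.sqrt_pos.2 hJ, Real.sq_sqrt hJ.le⟩
    rw [sq_mem_saddleSet5 hs, Set.mem_union, Set.mem_prod, Set.mem_prod,
      sq_mem_saddleActionsPos hs, sq_mem_saddleActionsNeg hs, mem_fivefoldAngles_zero,
      mem_fivefoldAngles_pi]
    tauto
  · refine iff_of_false (fun h => hJ h.1) ?_
    rintro (⟨⟨s, ⟨hs, -⟩, rfl⟩, -⟩ | ⟨⟨s, ⟨hs, -⟩, rfl⟩, -⟩)
    · exact hJ (by positivity)
    · have : 0 < s := by linarith
      exact hJ (by positivity)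

theorem fivefoldAngles_eq_image {c : ℝ} (h0 : 0 ≤ c) (h1 : c < 2 * Real.pi) :
    fivefoldAngles c =
      ((Finset.Ico (0 : ℤ) 5).image fun k : ℤ => (c + k * (2 * Real.pi)) / 5 : Finset ℝ) := by
  have hπ := Real.pi_pos
  ext φ
  simp only [fivefoldAngles, Set.mem_ofPred_eq, Set.mem_Ico, Finset.coe_image, Set.mem_image,
    Finset.mem_coe, Finset.mem_Ico]
  constructor
  · rintro ⟨⟨hφ0, hφ1⟩, k, hk⟩
    have hk0 : (-1 : ℝ) < k := by
      by_contra! h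
      nlinarith
    have hk5 : (k : ℝ) < 5 := by
      by_contra! h
      nlinarith
    have hk0' : -1 < k := by exact_mod_cast hk0
    exact ⟨k, ⟨by lia, by exact_mod_cast hk5⟩, by linarith⟩
  · rintro ⟨k, ⟨hk0, hk5⟩, rfl⟩
    have hk0' : (0 : ℝ) ≤ k := by exact_mod_cast hk0
    have hk4 : (k : ℝ) ≤ 4 := by exact_mod_cast (by lia : k ≤ 4)
    exact ⟨⟨by positivity, by nlinarith⟩, k, by ring⟩

theorem ncard_fivefoldAngles {c : ℝ} (h0 : 0 ≤ c) (h1 : c < 2 * Real.pi) :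
    (fivefoldAngles c).ncard = 5 := by
  rw [fivefoldAngles_eq_image h0 h1, Set.ncard_coe_finset, Finset.card_image_of_injective]
  · simp
  · intro k l h
    have hkl : ((k : ℝ) - l) * Real.pi = 0 := by
      simp only at h
      linarith
    have := (mul_eq_zero.1 hkl).resolve_right Real.pi_ne_zero
    exact_mod_cast sub_eq_zero.1 this

theorem finite_fivefoldAngles {c : ℝ} (h0 : 0 ≤ c) (h1 : c < 2 * Real.pi) :
    (fivefoldAngles c).Finite := by
  rw [fivefoldAngles_eq_image h0 h1]
  exact Finset.finite_toSet _

theorem saddleActionsPos_eq_empty {a : ℝ} (ha : 0 ≤ a) : saddleActionsPos a = ∅ := by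
  refine Set.image_eq_empty.2 (Set.eq_empty_of_forall_notMem ?_)
  rintro s ⟨hs, h⟩
  have : 0 < 2 * s ^ 2 + 5 / 2 * s ^ 3 := by positivity
  linarith

theorem saddleActionsNeg_eq_empty {a : ℝ} (ha : a ≤ -128 / 675) : saddleActionsNeg a = ∅ := by
  refine Set.image_eq_empty.2 (Set.eq_empty_of_forall_notMem ?_)
  rintro s ⟨hs, h⟩
  have hd : 0 < s - 8 / 15 := sub_pos.2 hs
  have : 0 < (s - 8 / 15) ^ 2 * (5 / 2 * s + 2 / 3) := by positivity
  nlinarith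

theorem exists_saddleActionsPos_eq {a : ℝ} (ha : a < 0) : ∃ J, saddleActionsPos a = {J} := by
  let f : ℝ → ℝ := fun s => a + 2 * s ^ 2 + 5 / 2 * s ^ 3
  have hf : ContinuousOn f (Set.Icc 0 (1 - a)) := by fun_prop
  obtain ⟨s, ⟨hs0, -⟩, hs⟩ := intermediate_value_Ioo (by linarith : 0 ≤ 1 - a) hf
    (show (0 : ℝ) ∈ Set.Ioo (f 0) (f (1 - a)) from
      ⟨by simpa [f] using ha, by
        have : 0 < (1 - a) ^ 3 := pow_pos (by linarith) 3
        simp only [f]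
        nlinarith⟩)
  refine ⟨s ^ 2, ?_⟩
  rw [saddleActionsPos, ← Set.image_singleton (f := fun s : ℝ => s ^ 2)]
  congr 1
  refine Set.eq_singleton_iff_unique_mem.2 ⟨⟨hs0, hs⟩, ?_⟩
  rintro t ⟨ht0, ht⟩
  have hmul : (t - s) * (2 * (t + s) + 5 / 2 * (t ^ 2 + t * s + s ^ 2)) = 0 := by
    simp only [f] at hs
    linear_combination ht - hs
  exact sub_eq_zero.1 ((mul_eq_zero.1 hmul).resolve_right (by positivity))

theorem exists_saddleActionsNeg_eq {a : ℝ} (ha : -128 / 675 < a) :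
    ∃ J, saddleActionsNeg a = {J} := by
  let f : ℝ → ℝ := fun s => 5 / 2 * s ^ 3 - 2 * s ^ 2 - a
  have hf : ContinuousOn f (Set.Icc (8 / 15) (2 + a)) := by fun_prop
  obtain ⟨s, ⟨hs0, -⟩, hs⟩ := intermediate_value_Ioo (by linarith : 8 / 15 ≤ 2 + a) hf
    (show (0 : ℝ) ∈ Set.Ioo (f (8 / 15)) (f (2 + a)) from
      ⟨by norm_num [f]; linarith, by
        have h1 : 1 < 2 + a := by linarith
        have h2 : 2 + a < (2 + a) ^ 2 := by nlinarith
        have h3 : 0 < (2 + a) ^ 2 * (5 / 2 * (2 + a) - 3) := by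
          have : 0 < 5 / 2 * (2 + a) - 3 := by linarith
          positivity
        simp only [f]
        nlinarith⟩)
  refine ⟨s ^ 2, ?_⟩
  rw [saddleActionsNeg, ← Set.image_singleton (f := fun s : ℝ => s ^ 2)]
  congr 1
  simp only [f] at hs
  refine Set.eq_singleton_iff_unique_mem.2 ⟨⟨hs0, by linarith⟩, ?_⟩
  rintro t ⟨ht0, ht⟩
  have hmul : (t - s) * (5 / 2 * (t ^ 2 + t * s + s ^ 2) - 2 * (t + s)) = 0 := by
    linear_combination -ht - hs
  refine sub_eq_zero.1 ((mul_eq_zero.1 hmul).resolve_right (ne_of_gt ?_))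
  have hu : 0 < t - 8 / 15 := sub_pos.2 ht0
  have hv : 0 < s - 8 / 15 := sub_pos.2 hs0
  nlinarith [mul_pos hu hv]

/-- The number of saddle critical points of `h̄(J,φ) = aJ + J² + J^(5/2)cos(5φ)`
with `J > 0`, `φ ∈ [0,2π)` equals `5` if `a > 0`, `10` if `−128/675 < a < 0`,
and `5` if `a < −128/675`. -/
theorem stmt_11 (a : ℝ) :
    (0 < a → (saddleSet5 a).ncard = 5) ∧
    (-128 / 675 < a → a < 0 → (saddleSet5 a).ncard = 10) ∧
    (a < -128 / 675 → (saddleSet5 a).ncard = 5) := by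
  have hπ := Real.pi_pos
  have h2π : Real.pi < 2 * Real.pi := by linarith
  have hP := ncard_fivefoldAngles le_rfl Real.two_pi_pos
  have hN := ncard_fivefoldAngles hπ.le h2π
  rw [saddleSet5_eq]
  refine ⟨fun ha => ?_, fun hl hr => ?_, fun ha => ?_⟩
  · obtain ⟨J, hJ⟩ := exists_saddleActionsNeg_eq (by linarith : -128 / 675 < a)
    rw [saddleActionsPos_eq_empty ha.le, hJ, Set.empty_prod, Set.empty_union, Set.ncard_prod, hN,
      Set.ncard_singleton]
  · obtain ⟨J, hJ⟩ := exists_saddleActionsPos_eq hr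
    obtain ⟨K, hK⟩ := exists_saddleActionsNeg_eq hl
    rw [hJ, hK, Set.ncard_union_eq _
      ((Set.finite_singleton J).prod (finite_fivefoldAngles le_rfl Real.two_pi_pos))
      ((Set.finite_singleton K).prod (finite_fivefoldAngles hπ.le h2π)),
      Set.ncard_prod, Set.ncard_prod, hP, hN, Set.ncard_singleton, Set.ncard_singleton]
    refine Set.disjoint_prod.2 (Or.inr (Set.disjoint_left.2 fun φ h0 h1 => ?_))
    linarith [(mem_fivefoldAngles_zero.1 h0).2, (mem_fivefoldAngles_pi.1 h1).2]
  · obtain ⟨J, hJ⟩ := exists_saddleActionsPos_eq (by linarith : a < 0)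
    rw [saddleActionsNeg_eq_empty ha.le, hJ, Set.empty_prod, Set.union_empty, Set.ncard_prod, hP,
      Set.ncard_singleton]
end

section
/- Let 0 < ε₁ < 1/10 and let a be real with |a| ≤ 2, and consider h̄₀(J,ψ) = aJ + J³ + cos ψ + ε₁·J·cos ψ for (J,ψ) ∈ ℝ². Call a critical point of h̄₀ a saddle if the determinant of the Hessian of h̄₀ there is negative. Then the critical points of h̄₀ are exactly the points with sin ψ = 0 and 3J² = −(a + ε₁·cos ψ), and the number of saddle critical points (J,ψ) with ψ ∈ [0, 2π) equals: 2 if a < −ε₁; 1 if −ε₁ < a < ε₁; and 0 if a > ε₁. -/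
/-- The Hamiltonian `h̄₀(J,ψ) = aJ + J³ + cos ψ + ε₁·J·cos ψ` modelling the
changes in critical level sets near the boundary of `D₁′` for `n ≥ 7`. -/
noncomputable def hbarModel (a ε₁ J ψ : ℝ) : ℝ :=
  a * J + J ^ 3 + Real.cos ψ + ε₁ * J * Real.cos ψ

/-- The set of saddle critical points of `h̄₀` with `ψ ∈ [0,2π)`: critical points
at which the Hessian determinant is negative. -/
noncomputable def saddleSetModel (a ε₁ : ℝ) : Set (ℝ × ℝ) :=
  {p | p.2 ∈ Set.Ico (0 : ℝ) (2 * Real.pi) ∧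
    deriv (fun J => hbarModel a ε₁ J p.2) p.1 = 0 ∧
    deriv (fun ψ => hbarModel a ε₁ p.1 ψ) p.2 = 0 ∧
    deriv (deriv (fun J => hbarModel a ε₁ J p.2)) p.1 *
        deriv (deriv (fun ψ => hbarModel a ε₁ p.1 ψ)) p.2 -
      (deriv (fun J => deriv (fun ψ => hbarModel a ε₁ J ψ) p.2) p.1) ^ 2 < 0}

theorem deriv_hbarModel_action (a ε J ψ : ℝ) :
    deriv (fun J' => hbarModel a ε J' ψ) J = a + 3 * J ^ 2 + ε * Real.cos ψ := by
  unfold hbarModel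
  have h := ((((hasDerivAt_id' J).const_mul a).add (hasDerivAt_pow 3 J)).add_const
    (Real.cos ψ)).add (((hasDerivAt_id' J).const_mul ε).mul_const (Real.cos ψ))
  refine (HasDerivAt.congr_deriv h ?_).deriv
  norm_num

theorem deriv_hbarModel_angle (a ε J ψ : ℝ) :
    deriv (fun ψ' => hbarModel a ε J ψ') ψ = -(1 + ε * J) * Real.sin ψ := by
  unfold hbarModel
  have h := ((Real.hasDerivAt_cos ψ).const_add (a * J + J ^ 3)).add
    ((Real.hasDerivAt_cos ψ).const_mul (ε * J))
  refine (HasDerivAt.congr_deriv h ?_).deriv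
  ring

theorem deriv_deriv_hbarModel_action (a ε J ψ : ℝ) :
    deriv (deriv (fun J' => hbarModel a ε J' ψ)) J = 6 * J := by
  rw [funext fun J' => deriv_hbarModel_action a ε J' ψ]
  have h := (((hasDerivAt_pow 2 J).const_mul 3).const_add a).add_const (ε * Real.cos ψ)
  refine (HasDerivAt.congr_deriv h ?_).deriv
  norm_num
  ring

theorem deriv_deriv_hbarModel_angle (a ε J ψ : ℝ) :
    deriv (deriv (fun ψ' => hbarModel a ε J ψ')) ψ = -(1 + ε * J) * Real.cos ψ := by
  rw [funext fun ψ' => deriv_hbarModel_angle a ε J ψ']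
  exact ((Real.hasDerivAt_sin ψ).const_mul (-(1 + ε * J))).deriv

theorem deriv_hbarModel_mixed (a ε J ψ : ℝ) :
    deriv (fun J' => deriv (fun ψ' => hbarModel a ε J' ψ') ψ) J = -ε * Real.sin ψ := by
  rw [funext fun J' => deriv_hbarModel_angle a ε J' ψ]
  have h := ((((hasDerivAt_id' J).const_mul ε).const_add 1).neg).mul_const (Real.sin ψ)
  refine (HasDerivAt.congr_deriv h ?_).deriv
  ring

theorem one_add_mul_pos_of_critical {a ε J c : ℝ} (hε : 0 < ε) (hε' : ε < 1 / 10)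
    (ha : |a| ≤ 2) (hc : |c| ≤ 1) (h : 3 * J ^ 2 = -(a + ε * c)) : 0 < 1 + ε * J := by
  obtain ⟨ha₁, -⟩ := abs_le.mp ha
  obtain ⟨hc₁, -⟩ := abs_le.mp hc
  have hJ : |J| ≤ 1 := by
    rw [← sq_le_one_iff_abs_le_one]
    nlinarith
  nlinarith [(abs_le.mp hJ).1]

theorem critical_hbarModel_iff {a ε : ℝ} (hε : 0 < ε) (hε' : ε < 1 / 10) (ha : |a| ≤ 2)
    (J ψ : ℝ) :
    (deriv (fun J' => hbarModel a ε J' ψ) J = 0 ∧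
      deriv (fun ψ' => hbarModel a ε J ψ') ψ = 0) ↔
    (Real.sin ψ = 0 ∧ 3 * J ^ 2 = -(a + ε * Real.cos ψ)) := by
  rw [deriv_hbarModel_action, deriv_hbarModel_angle]
  constructor
  · rintro ⟨h₁, h₂⟩
    have h : 3 * J ^ 2 = -(a + ε * Real.cos ψ) := by linarith
    have hpos := one_add_mul_pos_of_critical hε hε' ha (Real.abs_cos_le_one ψ) h
    exact ⟨(mul_eq_zero.mp h₂).resolve_left (by linarith), h⟩
  · rintro ⟨h₁, h₂⟩
    exact ⟨by linarith, by rw [h₁, mul_zero]⟩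

theorem sin_eq_zero_iff_of_mem_Ico {ψ : ℝ} (h : ψ ∈ Set.Ico (0 : ℝ) (2 * Real.pi)) :
    Real.sin ψ = 0 ↔ ψ = 0 ∨ ψ = Real.pi := by
  constructor
  · intro hs
    rcases lt_or_ge ψ Real.pi with hlt | hge
    · exact Or.inl ((Real.sin_eq_zero_iff_of_lt_of_lt (by linarith [h.1, Real.pi_pos]) hlt).mp hs)
    · have hs' : Real.sin (ψ - Real.pi) = 0 := by rw [Real.sin_sub_pi, hs, neg_zero]
      have := (Real.sin_eq_zero_iff_of_lt_of_lt (by linarith [Real.pi_pos])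
        (by linarith [h.2])).mp hs'
      exact Or.inr (by linarith)
  · rintro (rfl | rfl) <;> simp

theorem mem_saddleSetModel_iff {a ε : ℝ} (hε : 0 < ε) (hε' : ε < 1 / 10) (ha : |a| ≤ 2)
    (p : ℝ × ℝ) :
    p ∈ saddleSetModel a ε ↔
      (0 < p.1 ∧ 3 * p.1 ^ 2 = -(a + ε) ∧ p.2 = 0) ∨
      (p.1 < 0 ∧ 3 * p.1 ^ 2 = ε - a ∧ p.2 = Real.pi) := by
  obtain ⟨J, ψ⟩ := p
  have hπ := Real.pi_pos
  simp only [saddleSetModel, Set.mem_ofPred_eq]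
  rw [← and_assoc (a := deriv _ _ = 0), critical_hbarModel_iff hε hε' ha,
    deriv_deriv_hbarModel_action, deriv_deriv_hbarModel_angle, deriv_hbarModel_mixed]
  constructor
  · rintro ⟨hψ, ⟨hs, hc⟩, hd⟩
    have hpos := one_add_mul_pos_of_critical hε hε' ha (Real.abs_cos_le_one ψ) hc
    rcases (sin_eq_zero_iff_of_mem_Ico hψ).mp hs with rfl | rfl
    · simp only [Real.cos_zero, Real.sin_zero] at hc hd
      refine Or.inl ⟨?_, by linarith, rfl⟩
      by_contra! hJ
      nlinarith
    · simp only [Real.cos_pi, Real.sin_pi] at hc hd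
      refine Or.inr ⟨?_, by linarith, rfl⟩
      by_contra! hJ
      nlinarith
  · rintro (⟨hJ, hc, rfl⟩ | ⟨hJ, hc, rfl⟩)
    · refine ⟨⟨le_rfl, by linarith⟩, ⟨Real.sin_zero, ?_⟩, ?_⟩
      · rw [Real.cos_zero]; linarith
      · rw [Real.cos_zero, Real.sin_zero]
        nlinarith [mul_pos hε hJ]
    · have hc' : 3 * J ^ 2 = -(a + ε * Real.cos Real.pi) := by rw [Real.cos_pi]; linarith
      have hpos := one_add_mul_pos_of_critical hε hε' ha (Real.abs_cos_le_one _) hc'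
      refine ⟨⟨hπ.le, by linarith⟩, ⟨Real.sin_pi, hc'⟩, ?_⟩
      rw [Real.cos_pi, Real.sin_pi]
      nlinarith

theorem pos_and_three_mul_sq_eq_iff {b x : ℝ} (hb : 0 < b) :
    (0 < x ∧ 3 * x ^ 2 = b) ↔ x = √(b / 3) := by
  constructor
  · rintro ⟨hx, h⟩
    rw [← h, mul_div_cancel_left₀ _ three_ne_zero, Real.sqrt_sq hx.le]
  · rintro rfl
    refine ⟨Real.sqrt_pos.mpr (by positivity), ?_⟩
    rw [Real.sq_sqrt (by positivity)]
    ring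

theorem neg_and_three_mul_sq_eq_iff {b x : ℝ} (hb : 0 < b) :
    (x < 0 ∧ 3 * x ^ 2 = b) ↔ x = -√(b / 3) := by
  rw [← neg_eq_iff_eq_neg, ← pos_and_three_mul_sq_eq_iff hb, neg_sq, neg_pos]

/-- For `0 < ε₁ < 1/10` and `|a| ≤ 2`: the critical points of `h̄₀` are exactly
the points with `sin ψ = 0` and `3J² = −(a + ε₁ cos ψ)`, and the number of saddle
critical points with `ψ ∈ [0,2π)` equals `2` if `a < −ε₁`, `1` if `−ε₁ < a < ε₁`,
and `0` if `a > ε₁`. -/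
theorem stmt_14 (a ε₁ : ℝ) (hε₁ : 0 < ε₁) (hε₁' : ε₁ < 1 / 10) (ha : |a| ≤ 2) :
    (∀ J ψ : ℝ,
      (deriv (fun J' => hbarModel a ε₁ J' ψ) J = 0 ∧
        deriv (fun ψ' => hbarModel a ε₁ J ψ') ψ = 0) ↔
      (Real.sin ψ = 0 ∧ 3 * J ^ 2 = -(a + ε₁ * Real.cos ψ))) ∧
    (a < -ε₁ → (saddleSetModel a ε₁).ncard = 2) ∧
    (-ε₁ < a → a < ε₁ → (saddleSetModel a ε₁).ncard = 1) ∧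
    (ε₁ < a → (saddleSetModel a ε₁).ncard = 0) := by
  refine ⟨critical_hbarModel_iff hε₁ hε₁' ha, fun h => ?_, fun h₁ h₂ => ?_, fun h => ?_⟩
  · have : saddleSetModel a ε₁ =
        {(√(-(a + ε₁) / 3), 0), (-√((ε₁ - a) / 3), Real.pi)} := by
      ext p
      rw [mem_saddleSetModel_iff hε₁ hε₁' ha, ← and_assoc, ← and_assoc,
        pos_and_three_mul_sq_eq_iff (by linarith), neg_and_three_mul_sq_eq_iff (by linarith)]
      simp [Prod.ext_iff]
    rw [this]
    exact Set.ncard_pair fun h' => Real.pi_ne_zero (congrArg Prod.snd h').symm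
  · have : saddleSetModel a ε₁ = {(-√((ε₁ - a) / 3), Real.pi)} := by
      ext p
      rw [mem_saddleSetModel_iff hε₁ hε₁' ha,
        or_iff_right (fun hp => by nlinarith [hp.2.1, sq_nonneg p.1]), ← and_assoc,
        neg_and_three_mul_sq_eq_iff (by linarith)]
      simp [Prod.ext_iff]
    rw [this, Set.ncard_singleton]
  · have : saddleSetModel a ε₁ = ∅ := by
      ext p
      rw [mem_saddleSetModel_iff hε₁ hε₁' ha]
      simp only [Set.mem_empty_iff_false, iff_false]
      rintro (hp | hp) <;> nlinarith [hp.2.1, sq_nonneg p.1]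
    rw [this, Set.ncard_empty]
end

section
/- There exist ε₀ > 0 and C > 0 such that for every ε₁ ∈ [0, ε₀) there is a unique a ∈ (−2, −1) for which h̄₀(J₊, 0) = h̄₀(J₋, π), where J₊ = √(−(a + ε₁)/3) and J₋ = −√(−(a − ε₁)/3) are the two saddle critical points of h̄₀(J,ψ) = aJ + J³ + cos ψ + ε₁·J·cos ψ; moreover this value of a satisfies |a + 3·2^{−2/3}| ≤ C·ε₁². -/
/-- The two saddles lie on a common critical level set iff `J₊³ + |J₋|³ = 1`. -/
lemma hbarModel_saddles_eq_iff {a ε : ℝ} (hp : 0 ≤ -(a + ε) / 3) (hq : 0 ≤ -(a - ε) / 3) :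
    hbarModel a ε (Real.sqrt (-(a + ε) / 3)) 0 =
        hbarModel a ε (-Real.sqrt (-(a - ε) / 3)) Real.pi ↔
      Real.sqrt (-(a + ε) / 3) ^ 3 + Real.sqrt (-(a - ε) / 3) ^ 3 = 1 := by
  have hp2 := Real.sq_sqrt hp
  have hq2 := Real.sq_sqrt hq
  set p := Real.sqrt (-(a + ε) / 3)
  set q := Real.sqrt (-(a - ε) / 3)
  have hp3 : hbarModel a ε p 0 = 1 - 2 * p ^ 3 := by
    simp only [hbarModel, Real.cos_zero]
    linear_combination 3 * p * hp2
  have hq3 : hbarModel a ε (-q) Real.pi = 2 * q ^ 3 - 1 := by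
    simp only [hbarModel, Real.cos_pi]
    linear_combination -3 * q * hq2
  rw [hp3, hq3]
  constructor <;> intro h <;> linarith

lemma strictAntiOn_sqrt_pow_three_add {ε : ℝ} (h0 : 0 ≤ ε) (h1 : ε < 1) :
    StrictAntiOn (fun a : ℝ => Real.sqrt (-(a + ε) / 3) ^ 3 + Real.sqrt (-(a - ε) / 3) ^ 3)
      (Set.Iic (-1)) := by
  intro a ha b hb hab
  simp only [Set.mem_Iic] at ha hb
  have hp : Real.sqrt (-(b + ε) / 3) < Real.sqrt (-(a + ε) / 3) :=
    Real.sqrt_lt_sqrt (by linarith) (by linarith)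
  have hq : Real.sqrt (-(b - ε) / 3) < Real.sqrt (-(a - ε) / 3) :=
    Real.sqrt_lt_sqrt (by linarith) (by linarith)
  exact add_lt_add (by gcongr) (by gcongr)

lemma exists_sqrt_pow_three_add_eq_one {ε : ℝ} (h0 : 0 ≤ ε) (h1 : ε < 1 / 10) :
    ∃ a ∈ Set.Ioo (-2 : ℝ) (-1),
      Real.sqrt (-(a + ε) / 3) ^ 3 + Real.sqrt (-(a - ε) / 3) ^ 3 = 1 := by
  have hcont : ContinuousOn
      (fun a : ℝ => Real.sqrt (-(a + ε) / 3) ^ 3 + Real.sqrt (-(a - ε) / 3) ^ 3)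
      (Set.Icc (-2) (-1)) := by fun_prop
  refine intermediate_value_Ioo' (by norm_num) hcont ⟨?_, ?_⟩
  · have hp : Real.sqrt (-(-1 + ε) / 3) ≤ 0.7 := Real.sqrt_le_iff.2 ⟨by norm_num, by linarith⟩
    have hq : Real.sqrt (-(-1 - ε) / 3) ≤ 0.7 := Real.sqrt_le_iff.2 ⟨by norm_num, by linarith⟩
    have hp3 := pow_le_pow_left₀ (Real.sqrt_nonneg _) hp 3
    have hq3 := pow_le_pow_left₀ (Real.sqrt_nonneg _) hq 3
    norm_num at hp3 hq3 ⊢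
    linarith
  · have hp : 0.795 ≤ Real.sqrt (-(-2 + ε) / 3) := Real.le_sqrt_of_sq_le (by linarith)
    have hq : 0.81 ≤ Real.sqrt (-(-2 - ε) / 3) := Real.le_sqrt_of_sq_le (by linarith)
    have hp3 := pow_le_pow_left₀ (by norm_num) hp 3
    have hq3 := pow_le_pow_left₀ (by norm_num) hq 3
    norm_num at hp3 hq3 ⊢
    linarith

/-- If `p² = s - e`, `q² = s + e` and `p³ + q³ = 1`, then `4 s³ = 1` up to `O(e²)`. -/
lemma abs_four_mul_pow_three_sub_one_le {p q s e : ℝ} (hp : 0 ≤ p) (hq : 0 ≤ q) (hs : 0 < s)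
    (hp2 : p ^ 2 = s - e) (hq2 : q ^ 2 = s + e) (h : p ^ 3 + q ^ 3 = 1) :
    |4 * s ^ 3 - 1| ≤ 6 * s * e ^ 2 := by
  obtain ⟨m, hm⟩ : ∃ m, m = p * q := ⟨_, rfl⟩
  have hm0 : 0 ≤ m := hm ▸ mul_nonneg hp hq
  have hm2 : s ^ 2 - m ^ 2 = e ^ 2 := by
    rw [hm, mul_pow, hp2, hq2]; ring
  have hms : m ≤ s := by nlinarith [sq_nonneg e]
  have hsum : 2 * s ^ 3 + 6 * s * e ^ 2 + 2 * m ^ 3 = 1 := by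
    have h6 : (p ^ 2) ^ 3 + (q ^ 2) ^ 3 + 2 * m ^ 3 = 1 := by
      rw [hm]; linear_combination (p ^ 3 + q ^ 3 + 1) * h
    rw [hp2, hq2] at h6
    linear_combination h6
  have hlow : m ^ 3 ≤ s ^ 3 := pow_le_pow_left₀ hm0 hms 3
  have hupp : s ^ 3 - m ^ 3 ≤ 3 * s * e ^ 2 := by
    rw [← hm2]
    nlinarith [mul_nonneg (sub_nonneg.2 hms) (by nlinarith : 0 ≤ 2 * s ^ 2 + 2 * s * m - m ^ 2)]
  rw [abs_le]
  constructor <;> nlinarith [mul_nonneg hs.le (sq_nonneg e)]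

lemma sq_mul_abs_sub_le_abs_pow_three_sub {s t : ℝ} (hs : 0 ≤ s) (ht : 0 ≤ t) :
    s ^ 2 * |s - t| ≤ |s ^ 3 - t ^ 3| := by
  have hfac : s ^ 3 - t ^ 3 = (s ^ 2 + s * t + t ^ 2) * (s - t) := by ring
  have hpos : 0 ≤ s * t + t ^ 2 := by positivity
  rw [hfac, abs_mul, abs_of_nonneg (by positivity : 0 ≤ s ^ 2 + s * t + t ^ 2)]
  gcongr
  linarith

lemma abs_add_three_mul_two_rpow_le {a ε : ℝ} (h0 : 0 ≤ ε) (h1 : ε < 1)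
    (ha : a ∈ Set.Ioo (-2 : ℝ) (-1))
    (h : Real.sqrt (-(a + ε) / 3) ^ 3 + Real.sqrt (-(a - ε) / 3) ^ 3 = 1) :
    |a + 3 * (2 : ℝ) ^ (-(2 : ℝ) / 3)| ≤ 3 * ε ^ 2 := by
  obtain ⟨ha2, ha1⟩ := ha
  have hkey := abs_four_mul_pow_three_sub_one_le (s := -a / 3) (e := ε / 3)
    (Real.sqrt_nonneg _) (Real.sqrt_nonneg _) (by linarith)
    ((Real.sq_sqrt (by linarith)).trans (by ring))
    ((Real.sq_sqrt (by linarith)).trans (by ring)) h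
  have ht : (0 : ℝ) ≤ (2 : ℝ) ^ (-(2 : ℝ) / 3) := by positivity
  have ht3 : ((2 : ℝ) ^ (-(2 : ℝ) / 3)) ^ 3 = 1 / 4 := by
    rw [← Real.rpow_natCast, ← Real.rpow_mul (by norm_num)]
    norm_num [Real.rpow_neg]
  set t := (2 : ℝ) ^ (-(2 : ℝ) / 3)
  obtain ⟨s, rfl⟩ : ∃ s, a = -3 * s := ⟨-a / 3, by ring⟩
  rw [show -(-3 * s) / 3 = s by ring] at hkey
  have hdiff := sq_mul_abs_sub_le_abs_pow_three_sub (s := s) (by linarith) ht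
  have habs : |4 * s ^ 3 - 1| = 4 * |s ^ 3 - t ^ 3| := by
    rw [ht3, show 4 * s ^ 3 - 1 = 4 * (s ^ 3 - 1 / 4) by ring, abs_mul]
    norm_num
  have hgoal : |-3 * s + 3 * t| = 3 * |s - t| := by
    rw [show -3 * s + 3 * t = -3 * (s - t) by ring, abs_mul]
    norm_num
  have hs2 : 1 / 9 * |s - t| ≤ s ^ 2 * |s - t| := by
    gcongr
    nlinarith
  have hs1 : 6 * s * (ε / 3) ^ 2 ≤ 4 * (ε / 3) ^ 2 := by
    gcongr
    linarith
  rw [hgoal]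
  linarith

/-- There are `ε₀ > 0` and `C > 0` such that for every `ε₁ ∈ [0,ε₀)` there is a
unique `a ∈ (−2,−1)` with `h̄₀(J₊,0) = h̄₀(J₋,π)`, where `J₊ = √(−(a+ε₁)/3)` and
`J₋ = −√(−(a−ε₁)/3)` are the two saddles of `h̄₀`; moreover that `a` satisfies
`|a + 3·2^(−2/3)| ≤ C·ε₁²`. -/
theorem stmt_15 :
    ∃ ε₀ > (0 : ℝ), ∃ C > (0 : ℝ), ∀ ε₁ : ℝ, 0 ≤ ε₁ → ε₁ < ε₀ →
      ∃ a : ℝ,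
        (a ∈ Set.Ioo (-2 : ℝ) (-1) ∧
          hbarModel a ε₁ (Real.sqrt (-(a + ε₁) / 3)) 0 =
            hbarModel a ε₁ (-Real.sqrt (-(a - ε₁) / 3)) Real.pi ∧
          |a + 3 * (2 : ℝ) ^ (-(2 : ℝ) / 3)| ≤ C * ε₁ ^ 2) ∧
        (∀ a' : ℝ, a' ∈ Set.Ioo (-2 : ℝ) (-1) →
          hbarModel a' ε₁ (Real.sqrt (-(a' + ε₁) / 3)) 0 =
            hbarModel a' ε₁ (-Real.sqrt (-(a' - ε₁) / 3)) Real.pi →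
          a' = a) := by
  refine ⟨1 / 10, by norm_num, 3, by norm_num, fun ε h0 h1 => ?_⟩
  have hiff : ∀ b ∈ Set.Ioo (-2 : ℝ) (-1), _ := fun b hb =>
    hbarModel_saddles_eq_iff (a := b) (ε := ε) (by linarith [hb.2]) (by linarith [hb.2])
  obtain ⟨a, ha, h⟩ := exists_sqrt_pow_three_add_eq_one h0 h1
  refine ⟨a, ⟨ha, (hiff a ha).2 h, abs_add_three_mul_two_rpow_le h0 (by linarith) ha h⟩,
    fun b hb hb' => ?_⟩
  exact (strictAntiOn_sqrt_pow_three_add h0 (by linarith)).injOn hb.2.le ha.2.le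
    (((hiff b hb).1 hb').trans h.symm)
end
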